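/- arXiv:2303.05335 — 3 statements merged into one kernel-verified Lean document; each statement's English description precedes it below -/
import Mathlib

section
/- Let H be a right quaternionic Hilbert space and T ∈ B(H) a bounded right ℍ-linear operator. Then the right spectrum of T equals the S-spectrum of T: σ(T) = σ_S(T). -/
open MulOpposite Filter Topology Quaternion

noncomputable section

/- We model a right quaternionic Hilbert space as a real Banach space `H` equipped with a
right `ℍ`-module structure (encoded as a `ℍ[ℝ]ᵐᵒᵖ`-module, so that `x·q` is `op q • x`),
compatible with the real structure (`hreal`) and with the norm (`hnorm`). -/

variable {H : Type*} [NormedAddCommGroup H] [NormedSpace ℝ H] [Module ℍ[ℝ]ᵐᵒᵖ H]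

/-- The operator `T_λ : x ↦ x·λ - T x`. -/
def opTlam (T : H →L[ℝ] H) (l : ℍ[ℝ]) : H → H := fun x => op l • x - T x

/-- The operator `Δ_λ(T) = T² - 2 Re(λ) T + |λ|² I`. -/
def opDelta (T : H →L[ℝ] H) (l : ℍ[ℝ]) : H → H :=
  fun x => T (T x) - (2 * l.re) • T x + (‖l‖ ^ 2) • x

/-- A map is right `ℍ`-linear when it commutes with the right quaternionic scalar action
(together with additivity, which is automatic for the bundled maps we use). -/
def IsRightQLinear (S : H → H) : Prop := ∀ (q : ℍ[ℝ]) (x : H), S (op q • x) = op q • S x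

/-- Invertibility in `B_ℝ(H)`: existence of a two-sided inverse which is a bounded
`ℝ`-linear operator. -/
def InvertibleInBR (f : H → H) : Prop :=
  ∃ S : H →L[ℝ] H, (∀ x, S (f x) = x) ∧ (∀ x, f (S x) = x)

/-- Invertibility in `B(H)`: existence of a two-sided inverse which is a bounded
right `ℍ`-linear operator. -/
def InvertibleInBH (f : H → H) : Prop :=
  ∃ S : H →L[ℝ] H, IsRightQLinear (S : H → H) ∧ (∀ x, S (f x) = x) ∧ (∀ x, f (S x) = x)

/-- An operator is bounded below if `‖f x‖ ≥ k ‖x‖` for some `k > 0`. -/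
def BoundedBelowOp (f : H → H) : Prop := ∃ k > 0, ∀ x : H, k * ‖x‖ ≤ ‖f x‖

/-- The right spectrum `σ(T)`. -/
def rightSpectrum (T : H →L[ℝ] H) : Set ℍ[ℝ] := {l | ¬ InvertibleInBR (opTlam T l)}

/-- The S-spectrum `σ_S(T)`. -/
def sSpectrum (T : H →L[ℝ] H) : Set ℍ[ℝ] := {l | ¬ InvertibleInBH (opDelta T l)}

/-- The point spectrum `σ_p(T)`. -/
def pointSpectrum (T : H →L[ℝ] H) : Set ℍ[ℝ] := {l | ∃ x : H, x ≠ 0 ∧ opTlam T l x = 0}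

/-- The point S-spectrum `σ_{S,p}(T)`. -/
def sPointSpectrum (T : H →L[ℝ] H) : Set ℍ[ℝ] := {l | ∃ x : H, x ≠ 0 ∧ opDelta T l x = 0}

/-- The residual spectrum `σ_r(T)`. -/
def residualSpectrum (T : H →L[ℝ] H) : Set ℍ[ℝ] :=
  {l | l ∉ pointSpectrum T ∧ ¬ Dense (Set.range (opTlam T l))}

/-- The residual S-spectrum `σ_{S,r}(T)`. -/
def sResidualSpectrum (T : H →L[ℝ] H) : Set ℍ[ℝ] :=
  {l | l ∉ sPointSpectrum T ∧ ¬ Dense (Set.range (opDelta T l))}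

/-- The continuous spectrum `σ_c(T)`. -/
def continuousSpectrum (T : H →L[ℝ] H) : Set ℍ[ℝ] :=
  {l | l ∉ pointSpectrum T ∧ l ∉ residualSpectrum T ∧ ¬ BoundedBelowOp (opTlam T l)}

/-- The continuous S-spectrum `σ_{S,c}(T)`. -/
def sContinuousSpectrum (T : H →L[ℝ] H) : Set ℍ[ℝ] :=
  {l | l ∉ sPointSpectrum T ∧ l ∉ sResidualSpectrum T ∧ ¬ BoundedBelowOp (opDelta T l)}

/-- Right multiplication by `q`, as a bounded `ℝ`-linear operator. -/
def rightMulCLM (hreal : ∀ (r : ℝ) (x : H), op ((r : ℍ[ℝ])) • x = r • x)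
    (hnorm : ∀ (x : H) (q : ℍ[ℝ]), ‖op q • x‖ = ‖x‖ * ‖q‖) (q : ℍ[ℝ]) : H →L[ℝ] H :=
  LinearMap.mkContinuous
    { toFun := fun x => op q • x
      map_add' := fun x y => smul_add _ x y
      map_smul' := fun r x => by
        simp only [← hreal, smul_smul, ← op_mul, RingHom.id_apply]
        rw [Quaternion.coe_commutes] }
    ‖q‖ (fun x => by simp [hnorm, mul_comm])

theorem mul_eq_star_mul_of_orthogonal {q l : ℍ[ℝ]} (hre : q.re = 0)
    (him : q.imI * l.imI + q.imJ * l.imJ + q.imK * l.imK = 0) : q * l = star l * q := by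
  apply Quaternion.ext <;>
    simp only [Quaternion.re_mul, Quaternion.imI_mul, Quaternion.imJ_mul, Quaternion.imK_mul,
      Quaternion.re_star, Quaternion.imI_star, Quaternion.imJ_star, Quaternion.imK_star, hre] <;>
    linarith

/-- Every quaternion is conjugate to its quaternionic conjugate. -/
theorem exists_mul_eq_star_mul (l : ℍ[ℝ]) : ∃ q : ℍ[ℝ], q ≠ 0 ∧ q * l = star l * q := by
  by_cases h : l.imI = 0 ∧ l.imJ = 0
  · refine ⟨⟨0, 1, 0, 0⟩, fun h0 => ?_, mul_eq_star_mul_of_orthogonal rfl ?_⟩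
    · simpa using congrArg QuaternionAlgebra.imI h0
    · simp [h.1]
  · refine ⟨⟨0, -l.imJ, l.imI, 0⟩, fun h0 => h ⟨?_, ?_⟩, mul_eq_star_mul_of_orthogonal rfl ?_⟩
    · simpa using congrArg QuaternionAlgebra.imJ h0
    · simpa using congrArg QuaternionAlgebra.imI h0
    · dsimp only
      ring

theorem opTlam_opTlam_star {T : H →L[ℝ] H} (hT : IsRightQLinear (T : H → H))
    (hreal : ∀ (r : ℝ) (x : H), op ((r : ℍ[ℝ])) • x = r • x) (l : ℍ[ℝ]) (x : H) :
    opTlam T l (opTlam T (star l) x) = opDelta T l x := by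
  have hmul : op l • op (star l) • x = (‖l‖ ^ 2) • x := by
    rw [smul_smul, ← op_mul, Quaternion.star_mul_self, hreal, Quaternion.normSq_eq_norm_mul_self,
      pow_two]
  have hadd : op l • T x + op (star l) • T x = (2 * l.re) • T x := by
    rw [← add_smul, ← op_add, Quaternion.self_add_star', hreal]
  simp only [opTlam, opDelta, smul_sub, map_sub, hT (star l) x, hmul, ← hadd]
  abel

theorem opTlam_star_opTlam {T : H →L[ℝ] H} (hT : IsRightQLinear (T : H → H))
    (hreal : ∀ (r : ℝ) (x : H), op ((r : ℍ[ℝ])) • x = r • x) (l : ℍ[ℝ]) (x : H) :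
    opTlam T (star l) (opTlam T l x) = opDelta T l x := by
  have h := opTlam_opTlam_star hT hreal (star l) x
  rw [star_star] at h
  rw [h]
  simp [opDelta]

theorem opTlam_conj {T : H →L[ℝ] H} (hT : IsRightQLinear (T : H → H)) {l m q : ℍ[ℝ]}
    (h : q * l = m * q) (x : H) : opTlam T l (op q • x) = op q • opTlam T m x := by
  simp only [opTlam, smul_sub, smul_smul, ← op_mul, h, hT q x]

theorem InvertibleInBR.opTlam_of_conj {T : H →L[ℝ] H} (hT : IsRightQLinear (T : H → H))
    (hreal : ∀ (r : ℝ) (x : H), op ((r : ℍ[ℝ])) • x = r • x)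
    (hnorm : ∀ (x : H) (q : ℍ[ℝ]), ‖op q • x‖ = ‖x‖ * ‖q‖) {l m q : ℍ[ℝ]} (hq : q ≠ 0)
    (h : q * l = m * q) (hl : InvertibleInBR (opTlam T l)) : InvertibleInBR (opTlam T m) := by
  obtain ⟨S, hS₁, hS₂⟩ := hl
  have hinv : ∀ x : H, op q⁻¹ • op q • x = x := fun x => by
    rw [smul_smul, ← op_mul, mul_inv_cancel₀ hq, op_one, one_smul]
  have hinv' : ∀ x : H, op q • op q⁻¹ • x = x := fun x => by
    rw [smul_smul, ← op_mul, inv_mul_cancel₀ hq, op_one, one_smul]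
  have hinj : Function.Injective fun x : H => op q • x := Function.LeftInverse.injective hinv
  refine ⟨(rightMulCLM hreal hnorm q⁻¹).comp (S.comp (rightMulCLM hreal hnorm q)),
    fun x => ?_, fun x => ?_⟩
  · change op q⁻¹ • S (op q • opTlam T m x) = x
    rw [← opTlam_conj hT h, hS₁, hinv]
  · change opTlam T m (op q⁻¹ • S (op q • x)) = x
    apply hinj
    change op q • opTlam T m (op q⁻¹ • S (op q • x)) = op q • x
    rw [← opTlam_conj hT h, hinv', hS₂]

theorem IsRightQLinear.opDelta {T : H →L[ℝ] H} (hT : IsRightQLinear (T : H → H))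
    (hreal : ∀ (r : ℝ) (x : H), op ((r : ℍ[ℝ])) • x = r • x) (l : ℍ[ℝ]) :
    IsRightQLinear (opDelta T l) := by
  intro q x
  have hcomm : ∀ (r : ℝ) (y : H), r • op q • y = op q • r • y := fun r y => by
    simp only [← hreal, smul_smul, ← op_mul]
    rw [Quaternion.coe_commutes]
  simp only [_root_.opDelta, hT q, smul_sub, smul_add, hcomm]

theorem IsRightQLinear.of_inverse {E : Type*} [NormedAddCommGroup E] [Module ℍ[ℝ]ᵐᵒᵖ E]
    {f g : E → E} (hf : IsRightQLinear f)
    (hgf : ∀ x, g (f x) = x) (hfg : ∀ x, f (g x) = x) : IsRightQLinear g := fun q x => by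
  rw [← hgf (op q • g x), hf q, hfg]

theorem invertibleInBR_opTlam_iff_invertibleInBH_opDelta {T : H →L[ℝ] H}
    (hT : IsRightQLinear (T : H → H))
    (hreal : ∀ (r : ℝ) (x : H), op ((r : ℍ[ℝ])) • x = r • x)
    (hnorm : ∀ (x : H) (q : ℍ[ℝ]), ‖op q • x‖ = ‖x‖ * ‖q‖) (l : ℍ[ℝ]) :
    InvertibleInBR (opTlam T l) ↔ InvertibleInBH (opDelta T l) := by
  constructor
  · intro hl
    obtain ⟨q, hq, hql⟩ := exists_mul_eq_star_mul l
    obtain ⟨S', hS'₁, hS'₂⟩ := hl.opTlam_of_conj hT hreal hnorm hq hql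
    obtain ⟨S, hS₁, hS₂⟩ := hl
    have hleft : ∀ x, (S'.comp S) (opDelta T l x) = x := fun x => by
      rw [← opTlam_opTlam_star hT hreal, ContinuousLinearMap.comp_apply, hS₁, hS'₁]
    have hright : ∀ x, opDelta T l ((S'.comp S) x) = x := fun x => by
      rw [← opTlam_opTlam_star hT hreal, ContinuousLinearMap.comp_apply, hS'₂, hS₂]
    exact ⟨S'.comp S, (hT.opDelta hreal l).of_inverse hleft hright, hleft, hright⟩
  · rintro ⟨S, -, hS₁, hS₂⟩
    let A : H →L[ℝ] H := rightMulCLM hreal hnorm (star l) - T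
    have hA : ∀ x, A x = opTlam T (star l) x := fun _ => rfl
    have hleft : ∀ x, S (A (opTlam T l x)) = x := fun x => by
      rw [hA, opTlam_star_opTlam hT hreal, hS₁]
    have hright : ∀ x, opTlam T l (A (S x)) = x := fun x => by
      rw [hA, opTlam_opTlam_star hT hreal, hS₂]
    refine ⟨S.comp A, hleft, fun x => ?_⟩
    have hcomm : S (A x) = A (S x) := by
      conv_lhs => rw [← hright x]
      exact hleft _
    rw [ContinuousLinearMap.comp_apply, hcomm, hright]

/-- The right spectrum equals the S-spectrum: `σ(T) = σ_S(T)`. -/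
theorem right_spectrum_eq_sSpectrum [CompleteSpace H] (T : H →L[ℝ] H)
    (hT : IsRightQLinear (T : H → H))
    (hreal : ∀ (r : ℝ) (x : H), op ((r : ℍ[ℝ])) • x = r • x)
    (hnorm : ∀ (x : H) (q : ℍ[ℝ]), ‖op q • x‖ = ‖x‖ * ‖q‖) :
    rightSpectrum T = sSpectrum T := by
  ext l
  exact not_congr (invertibleInBR_opTlam_iff_invertibleInBH_opDelta hT hreal hnorm l)
end
end

section
/- Let H be a right quaternionic Hilbert space and T ∈ B(H). Then the point spectrum of T equals the point S-spectrum of T: σ_p(T) = σ_{S,p}(T), i.e., for λ ∈ ℍ, there exists a nonzero x ∈ H with T_λ(x) = 0 if and only if there exists a nonzero x ∈ H with Δ_λ(T)(x) = 0. -/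
open MulOpposite Filter Topology Quaternion

noncomputable section

/- We model a right quaternionic Hilbert space as a real Banach space `H` equipped with a
right `ℍ`-module structure (encoded as a `ℍ[ℝ]ᵐᵒᵖ`-module, so that `x·q` is `op q • x`),
compatible with the real structure (`hreal`) and with the norm (`hnorm`). -/

variable {H : Type*} [NormedAddCommGroup H] [NormedSpace ℝ H] [Module ℍ[ℝ]ᵐᵒᵖ H]

/-- A purely imaginary quaternion orthogonal to `l` intertwines `l` with `star l`. -/
theorem star_mul_eq_mul_of_orthogonal (l q : ℍ[ℝ]) (hre : q.re = 0)
    (horth : l.imI * q.imI + l.imJ * q.imJ + l.imK * q.imK = 0) : star l * q = q * l := by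
  ext <;> simp [hre] <;> linarith

/-- Every quaternion is conjugate to its `star` by a nonzero quaternion. -/
theorem exists_ne_zero_star_mul_eq_mul (l : ℍ[ℝ]) : ∃ q : ℍ[ℝ], q ≠ 0 ∧ star l * q = q * l := by
  by_cases h : l.imI = 0 ∧ l.imJ = 0
  · refine ⟨⟨0, 1, 0, 0⟩, fun hq => ?_, star_mul_eq_mul_of_orthogonal _ _ rfl (by simp [h.1])⟩
    simpa using congrArg QuaternionAlgebra.imI hq
  · refine ⟨⟨0, l.imJ, -l.imI, 0⟩, fun hq => h ⟨?_, ?_⟩,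
      star_mul_eq_mul_of_orthogonal _ _ rfl (by ring)⟩
    · simpa using congrArg QuaternionAlgebra.imJ hq
    · simpa using congrArg QuaternionAlgebra.imI hq

theorem coe_norm_sq_eq_mul_star (l : ℍ[ℝ]) : ((‖l‖ ^ 2 : ℝ) : ℍ[ℝ]) = l * star l := by
  rw [Quaternion.self_mul_star, Quaternion.normSq_eq_norm_mul_self, sq]

theorem coe_two_mul_re_eq_add_star (l : ℍ[ℝ]) : ((2 * l.re : ℝ) : ℍ[ℝ]) = l + star l :=
  (Quaternion.self_add_star' l).symm

/-- `Δ_λ(T)` vanishes at `x` exactly when `T x - x·λ̄` satisfies the eigenvalue equation. -/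
theorem opDelta_eq (T : H →L[ℝ] H) (hT : IsRightQLinear (T : H → H))
    (hreal : ∀ (r : ℝ) (x : H), op ((r : ℍ[ℝ])) • x = r • x) (l : ℍ[ℝ]) (x : H) :
    opDelta T l x = -opTlam T l (T x - op (star l) • x) := by
  rw [opDelta, opTlam, ← hreal, ← hreal, coe_norm_sq_eq_mul_star, coe_two_mul_re_eq_add_star,
    map_sub, hT, smul_sub, smul_smul, ← op_mul, star_comm_self' l, op_add, add_smul]
  abel

/-- The point spectrum equals the point S-spectrum: `σ_p(T) = σ_{S,p}(T)`. -/
theorem point_spectrum_eq_sPointSpectrum [CompleteSpace H] (T : H →L[ℝ] H)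
    (hT : IsRightQLinear (T : H → H))
    (hreal : ∀ (r : ℝ) (x : H), op ((r : ℍ[ℝ])) • x = r • x)
    (hnorm : ∀ (x : H) (q : ℍ[ℝ]), ‖op q • x‖ = ‖x‖ * ‖q‖) :
    pointSpectrum T = sPointSpectrum T := by
  ext l
  constructor
  · rintro ⟨x, hx, h⟩
    refine ⟨x, hx, ?_⟩
    have hTx : T x = op l • x := (sub_eq_zero.mp h).symm
    rw [opDelta, ← hreal, ← hreal, coe_norm_sq_eq_mul_star, coe_two_mul_re_eq_add_star, hTx, hT,
      hTx, smul_smul, smul_smul, ← op_mul, ← op_mul, mul_add, op_add, add_smul]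
    abel
  · rintro ⟨x, hx, h⟩
    rw [opDelta_eq T hT hreal, neg_eq_zero] at h
    by_cases hy : T x - op (star l) • x = 0
    · obtain ⟨q, hq, hql⟩ := exists_ne_zero_star_mul_eq_mul l
      refine ⟨op q • x, smul_ne_zero (by simpa using hq) hx, ?_⟩
      rw [opTlam, hT, sub_eq_zero.mp hy, smul_smul, smul_smul, ← op_mul, ← op_mul, hql, sub_self]
    · exact ⟨_, hy, h⟩
end
end

section
/- Let H be a right quaternionic Hilbert space and T ∈ B(H). The residual spectrum σ_r(T) is a circular subset of ℍ: if λ ∈ σ_r(T) and q ∈ ℍ with |q| = 1, then qλq* ∈ σ_r(T). -/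
open MulOpposite Filter Topology Quaternion

noncomputable section

/- We model a right quaternionic Hilbert space as a real Banach space `H` equipped with a
right `ℍ`-module structure (encoded as a `ℍ[ℝ]ᵐᵒᵖ`-module, so that `x·q` is `op q • x`),
compatible with the real structure (`hreal`) and with the norm (`hnorm`). -/

variable {H : Type*} [NormedAddCommGroup H] [NormedSpace ℝ H] [Module ℍ[ℝ]ᵐᵒᵖ H]

theorem star_mul_self_of_norm_eq_one {q : ℍ[ℝ]} (hq : ‖q‖ = 1) : star q * q = 1 := by
  rw [Quaternion.star_mul_self, Quaternion.normSq_eq_norm_mul_self, hq]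
  simp

theorem self_mul_star_of_norm_eq_one {q : ℍ[ℝ]} (hq : ‖q‖ = 1) : q * star q = 1 := by
  rw [Quaternion.self_mul_star, Quaternion.normSq_eq_norm_mul_self, hq]
  simp

theorem op_smul_op_star_smul {E : Type*} [NormedAddCommGroup E] [Module ℍ[ℝ]ᵐᵒᵖ E]
    {q : ℍ[ℝ]} (hq : ‖q‖ = 1) (x : E) :
    op q • op (star q) • x = x := by
  rw [smul_smul, ← op_mul, star_mul_self_of_norm_eq_one hq, op_one, one_smul]

theorem op_star_smul_op_smul {E : Type*} [NormedAddCommGroup E] [Module ℍ[ℝ]ᵐᵒᵖ E]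
    {q : ℍ[ℝ]} (hq : ‖q‖ = 1) (x : E) :
    op (star q) • op q • x = x := by
  rw [smul_smul, ← op_mul, self_mul_star_of_norm_eq_one hq, op_one, one_smul]

/-- `T_{qλq*}` is conjugate to `T_λ` by right multiplication by `q`. -/
theorem op_smul_opTlam_conj {T : H →L[ℝ] H} (hT : IsRightQLinear (T : H → H))
    (l : ℍ[ℝ]) {q : ℍ[ℝ]} (hq : ‖q‖ = 1) (x : H) :
    op q • opTlam T (q * l * star q) x = opTlam T l (op q • x) := by
  simp only [opTlam, op_mul, mul_smul, smul_sub, hT q x, op_smul_op_star_smul hq]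

theorem continuous_op_smul {E : Type*} [NormedAddCommGroup E] [Module ℍ[ℝ]ᵐᵒᵖ E]
    (hnorm : ∀ (x : E) (q : ℍ[ℝ]), ‖op q • x‖ = ‖x‖ * ‖q‖) (q : ℍ[ℝ]) :
    Continuous fun x : E => op q • x :=
  AddMonoidHomClass.continuous_of_bound (DistribSMul.toAddMonoidHom E (op q)) ‖q‖
    fun x => ((hnorm x q).trans (mul_comm _ _)).le

/-- The residual spectrum is circular: if `λ ∈ σ_r(T)` and `|q| = 1` then `qλq* ∈ σ_r(T)`. -/
theorem residualSpectrum_circular [CompleteSpace H] (T : H →L[ℝ] H)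
    (hT : IsRightQLinear (T : H → H))
    (hreal : ∀ (r : ℝ) (x : H), op ((r : ℍ[ℝ])) • x = r • x)
    (hnorm : ∀ (x : H) (q : ℍ[ℝ]), ‖op q • x‖ = ‖x‖ * ‖q‖)
    (l q : ℍ[ℝ]) (hq : ‖q‖ = 1) (hl : l ∈ residualSpectrum T) :
    q * l * star q ∈ residualSpectrum T := by
  obtain ⟨hp, hd⟩ := hl
  refine ⟨fun ⟨x, hx, hx0⟩ => hp ⟨op q • x, fun h => hx ?_, ?_⟩, fun hdense => hd ?_⟩
  · rw [← op_star_smul_op_smul hq x, h, smul_zero]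
  · rw [← op_smul_opTlam_conj hT l hq, hx0, smul_zero]
  · have hsurj : Function.Surjective fun x : H => op q • x :=
      fun x => ⟨op (star q) • x, op_smul_op_star_smul hq x⟩
    refine (hsurj.denseRange.dense_image (continuous_op_smul hnorm q) hdense).mono ?_
    rintro _ ⟨_, ⟨x, rfl⟩, rfl⟩
    exact ⟨op q • x, (op_smul_opTlam_conj hT l hq x).symm⟩
end
end
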